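/- Let q = pⁿ be a prime power and let A be an integral domain containing F_q with unit group A^× exactly the nonzero constants F_q^×, such that deg a := dim_{F_q}(A/aA) is finite for every nonzero a ∈ A, each V_n := {a ∈ A : a = 0 or deg a ≤ n} is an F_q-subspace of A with dim_{F_q} V_n = 1 + card{m : 1 ≤ m ≤ n, m is not a gap of A}, and the number g of gaps of A is finite. Assume A has an r-gap structure at ∞ with r ≥ q − 1, i.e. dim_{F_q} V_{iq} = i + 1 for 1 ≤ i ≤ r, dim_{F_q} V_{g+r} = r + 1, and rq ≤ g + r. Then for every positive integer s that is a multiple of q − 1 and satisfies l_q(s) ≤ r(q − 1), the polynomial Z_s(X) := ∑_{d≥0} (∑_{a ∈ A∖{0}, deg a = d} a^s) X^d ∈ A[X] (all but finitely many inner sums vanish) has a zero at X = 1 of order exactly q; i.e., the order of vanishing of ζ(−s) is q. -/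

import Mathlib

open Polynomial

/-- `lq q k` is the sum of the base-`q` digits of `k`. -/
def lq (q k : ℕ) : ℕ := (Nat.digits q k).sum

/-- The degree of a nonzero element `a` of a ring `A` containing a field `F`:
`deg a = dim_F (A / aA)`. -/
noncomputable def adeg (F : Type*) {A : Type*} [Field F] [CommRing A] [Algebra F A]
    (a : A) : ℕ :=
  Module.finrank F (A ⧸ Ideal.span {a})

/-- A positive integer `m` is a gap of `A` (at `∞`) if no nonzero `a ∈ A` has `deg a = m`. -/
def IsGapA (F : Type*) (A : Type*) [Field F] [CommRing A] [Algebra F A] (m : ℕ) : Prop :=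
  ¬ ∃ a : A, a ≠ 0 ∧ adeg F a = m

/-- The `d`-th coefficient `∑_{a ∈ A∖{0}, deg a = d} a^s` of the zeta polynomial of `A`. -/
noncomputable def zetaCoeff (F : Type*) {A : Type*} [Field F] [CommRing A] [Algebra F A]
    (s d : ℕ) : A :=
  ∑ᶠ a ∈ {a : A | a ≠ 0 ∧ adeg F a = d}, a ^ s

/-- The zeta polynomial `Z_s(X) = ∑_{d ≥ 0} (∑_{a ∈ A∖{0}, deg a = d} a^s) X^d ∈ A[X]`. -/
noncomputable def zetaPoly (F : Type*) (A : Type*) [Field F] [CommRing A] [Algebra F A]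
    (s : ℕ) : Polynomial A :=
  ∑ᶠ d : ℕ, C (zetaCoeff F s d) * X ^ d

theorem adeg_mul (F : Type*) {A : Type*} [Field F] [CommRing A] [IsDomain A] [Algebra F A]
    (hdegfin : ∀ a : A, a ≠ 0 → Module.Finite F (A ⧸ Ideal.span {a}))
    {a b : A} (ha : a ≠ 0) (hb : b ≠ 0) : adeg F (a * b) = adeg F a + adeg F b := by
  have := hdegfin _ (mul_ne_zero ha hb)
  have hle : Ideal.span {a * b} ≤ Ideal.span {a} := by
    rw [Ideal.span_singleton_le_span_singleton]; exact dvd_mul_right a b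
  let f : (A ⧸ Ideal.span {a * b}) →ₗ[F] (A ⧸ Ideal.span {a}) :=
    (Ideal.Quotient.factorₐ F hle).toLinearMap
  let g₀ : (A ⧸ Ideal.span {b}) →ₗ[A] (A ⧸ Ideal.span {a * b}) :=
    Submodule.mapQ _ _ (LinearMap.mulLeft A a) (by
      intro c hc
      obtain ⟨d, rfl⟩ := Ideal.mem_span_singleton.1 hc
      exact Ideal.mem_span_singleton.2 ⟨d, by simp [mul_assoc]⟩)
  let g := g₀.restrictScalars F
  have hg : Function.Injective g := by
    refine (injective_iff_map_eq_zero g).2 fun y hy => ?_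
    obtain ⟨y, rfl⟩ := Ideal.Quotient.mk_surjective y
    have h1 : (Ideal.Quotient.mk (Ideal.span {a * b})) (a * y) = 0 := hy
    rw [Ideal.Quotient.eq_zero_iff_mem, Ideal.mem_span_singleton,
      mul_dvd_mul_iff_left ha] at h1
    rwa [Ideal.Quotient.eq_zero_iff_mem, Ideal.mem_span_singleton]
  have hf : Function.Surjective f := Ideal.Quotient.factor_surjective hle
  have hker : LinearMap.ker f = LinearMap.range g := by
    ext y
    obtain ⟨y, rfl⟩ := Ideal.Quotient.mk_surjective y
    rw [LinearMap.mem_ker, LinearMap.mem_range]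
    constructor
    · intro hy
      have h1 : (Ideal.Quotient.mk (Ideal.span {a})) y = 0 := hy
      rw [Ideal.Quotient.eq_zero_iff_mem, Ideal.mem_span_singleton] at h1
      obtain ⟨d, rfl⟩ := h1
      exact ⟨Ideal.Quotient.mk _ d, rfl⟩
    · rintro ⟨d, hd⟩
      obtain ⟨d, rfl⟩ := Ideal.Quotient.mk_surjective d
      rw [← hd]
      change (Ideal.Quotient.mk (Ideal.span {a})) (a * d) = 0
      rw [Ideal.Quotient.eq_zero_iff_mem, Ideal.mem_span_singleton]
      exact dvd_mul_right a d
  have h := LinearMap.finrank_range_add_finrank_ker f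
  rw [hker, LinearMap.finrank_range_of_inj hg, LinearMap.range_eq_top.2 hf, finrank_top] at h
  exact h.symm

theorem lq_eq_mod_add_div {q s : ℕ} (hq : 1 < q) (hs : 0 < s) :
    lq q s = s % q + lq q (s / q) := by
  simp [lq, Nat.digits_def' hq hs]

theorem exists_mvPolynomial_pow_sum {F A σ : Type*} [Field F] [Fintype F] [CommRing A]
    [Algebra F A] [Fintype σ] (s : ℕ) (w : σ → A) :
    ∃ f : MvPolynomial σ A, f.totalDegree ≤ lq (Fintype.card F) s ∧
      ∀ c : σ → F, MvPolynomial.eval (fun i => algebraMap F A (c i)) f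
        = (∑ i, c i • w i) ^ s := by
  induction s using Nat.strong_induction_on generalizing w with
  | _ s ih =>
    rcases Nat.eq_zero_or_pos s with rfl | hs
    · exact ⟨1, by simp, by simp⟩
    have hq : 1 < Fintype.card F := Fintype.one_lt_card
    obtain ⟨f, hf, hfe⟩ := ih (s / Fintype.card F) (Nat.div_lt_self hs hq)
      (fun i => w i ^ Fintype.card F)
    refine ⟨(∑ i, MvPolynomial.C (w i) * MvPolynomial.X i) ^ (s % Fintype.card F) * f, ?_,
      fun c => ?_⟩
    · rw [lq_eq_mod_add_div hq hs]
      refine (MvPolynomial.totalDegree_mul _ _).trans (add_le_add ?_ hf)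
      refine (MvPolynomial.totalDegree_pow _ _).trans ?_
      refine (Nat.mul_le_mul_left _ (MvPolynomial.totalDegree_finsetSum_le (d := 1)
        fun i _ => ?_)).trans (mul_one _).le
      have h : MvPolynomial.C (w i) * MvPolynomial.X i
          = MvPolynomial.monomial (Finsupp.single i 1) (w i) := by
        rw [MvPolynomial.C_mul_X_eq_monomial]
      rw [h]
      refine (MvPolynomial.totalDegree_monomial_le _ _).trans ?_
      simp
    · have hfrob : ∑ i, c i • w i ^ Fintype.card F = (∑ i, c i • w i) ^ Fintype.card F := by
        have := map_sum (FiniteField.frobeniusAlgHom F A) (fun i => c i • w i) Finset.univ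
        simp only [map_smul, FiniteField.coe_frobeniusAlgHom] at this
        exact this.symm
      rw [map_mul, hfe, hfrob, map_pow, map_sum, ← pow_mul]
      simp only [map_mul, MvPolynomial.eval_C, MvPolynomial.eval_X]
      rw [show ∑ i, w i * algebraMap F A (c i) = ∑ i, c i • w i from
        Finset.sum_congr rfl fun i _ => by rw [Algebra.smul_def, mul_comm], ← pow_add,
        Nat.mod_add_div]

theorem sum_eval_algebraMap_eq_zero {F A σ : Type*} [Field F] [Fintype F] [CommRing A]
    [Algebra F A] [Fintype σ] [DecidableEq σ] (f : MvPolynomial σ A)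
    (hf : f.totalDegree < (Fintype.card F - 1) * Fintype.card σ) :
    ∑ c : σ → F, MvPolynomial.eval (fun i => algebraMap F A (c i)) f = 0 := by
  simp only [MvPolynomial.eval_eq]
  rw [Finset.sum_comm]
  refine Finset.sum_eq_zero fun d hd => ?_
  rw [← Finset.mul_sum]
  have hd' : (MvPolynomial.monomial d (1 : F)).totalDegree
      < (Fintype.card F - 1) * Fintype.card σ :=
    (MvPolynomial.totalDegree_monomial_le _ _).trans_lt
      ((MvPolynomial.le_totalDegree hd).trans_lt hf)
  have h := congrArg (algebraMap F A) (MvPolynomial.sum_eval_eq_zero _ hd')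
  simp only [MvPolynomial.eval_monomial, one_mul, map_sum, map_zero, Finsupp.prod, map_prod,
    map_pow] at h
  rw [h, mul_zero]

theorem sum_submodule_pow_eq_zero {F A : Type*} [Field F] [Fintype F] [CommRing A]
    [Algebra F A] (W : Submodule F A) [Module.Finite F W] [Fintype W] {s : ℕ}
    (hs : lq (Fintype.card F) s < (Fintype.card F - 1) * Module.finrank F W) :
    ∑ w : W, (w : A) ^ s = 0 := by
  classical
  let b := Module.finBasis F W
  obtain ⟨f, hf, hfe⟩ := exists_mvPolynomial_pow_sum (F := F) s (fun i => (b i : A))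
  rw [← b.equivFun.symm.toEquiv.sum_comp]
  refine Eq.trans (Finset.sum_congr rfl fun c _ => ?_)
    (sum_eval_algebraMap_eq_zero f (hf.trans_lt (by simpa using hs)))
  rw [hfe]
  simp [Module.Basis.equivFun_symm_apply]

theorem sum_submodule_map_pow_eq_zero {F A B : Type*} [Field F] [Fintype F] [CommRing A]
    [Algebra F A] [CommRing B] [Algebra F B] (φ : A →ₐ[F] B) (W : Submodule F A) [Fintype W]
    {x : A} (hxW : x ∈ W) (hx : x ≠ 0) (hφ : φ x = 0) (s : ℕ) :
    ∑ w : W, φ (w : A) ^ s = 0 := by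
  classical
  have hx' : (⟨x, hxW⟩ : W) ≠ 0 := fun h => hx (congrArg Subtype.val h)
  let K : Submodule F W := Submodule.span F {⟨x, hxW⟩}
  obtain ⟨C, hC⟩ := K.exists_isCompl
  have hK : (Fintype.card K : B) = 0 := by
    have h := Fintype.card_congr (LinearEquiv.toSpanNonzeroSingleton F W _ hx').toEquiv
    rw [← Fintype.card_congr' (rfl : (F ∙ (⟨x, hxW⟩ : W) : Type _) = K), ← h,
      ← map_natCast (algebraMap F B), FiniteField.cast_card_eq_zero, map_zero]
  have hφK : ∀ k : K, φ ((k : W) : A) = 0 := by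
    rintro ⟨k, hk⟩
    obtain ⟨t, rfl⟩ := Submodule.mem_span_singleton.1 hk
    simp [hφ]
  rw [← (Submodule.prodEquivOfIsCompl K C hC).toEquiv.sum_comp, Fintype.sum_prod_type]
  simp [hφK, hK]

theorem sum_pow_eq_neg_one (F : Type*) [Field F] [Fintype F] {s : ℕ} (hs : s ≠ 0)
    (hdvd : Fintype.card F - 1 ∣ s) : ∑ t : F, t ^ s = -1 := by
  classical
  have h : ∀ t : F, t ^ s = 1 - if t = 0 then 1 else 0 := by
    intro t
    obtain ⟨k, rfl⟩ := hdvd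
    split_ifs with ht
    · simp [ht, hs]
    · rw [pow_mul, FiniteField.pow_card_sub_one_eq_one t ht]; simp
  simp [h]

theorem mem_iff_dvd_of_ncard_eq {S : Set ℕ} {q r : ℕ} (hq : 1 < q) (hr : q - 1 ≤ r)
    (hmul : ∀ m ∈ S, ∀ k, 1 ≤ k → k * m ∈ S)
    (hcard : ∀ i, 1 ≤ i → i ≤ r → {m | 1 ≤ m ∧ m ≤ i * q ∧ m ∈ S}.ncard = i)
    {m : ℕ} (hm : 1 ≤ m) (hmr : m ≤ r * q) : m ∈ S ↔ q ∣ m := by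
  have hfin : ∀ n, {m | 1 ≤ m ∧ m ≤ n ∧ m ∈ S}.Finite := fun n =>
    (Set.finite_Icc 1 n).subset fun m hm => ⟨hm.1, hm.2.1⟩
  have hcard' : ∀ i, i ≤ r → {m | 1 ≤ m ∧ m ≤ i * q ∧ m ∈ S}.ncard = i := by
    intro i hi
    rcases Nat.eq_zero_or_pos i with rfl | h
    · rw [Set.ncard_eq_zero (hfin _)]
      ext m
      simp only [Set.mem_ofPred_eq, Set.mem_empty_iff_false, iff_false]
      omega
    · exact hcard i h hi
  have huniq : ∀ i, i < r → ∀ a ∈ S, ∀ b ∈ S, i * q < a → a < b → b ≤ (i + 1) * q → False := by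
    intro i hi a ha b hb hia hab hbi
    have hsub : insert b (insert a {m | 1 ≤ m ∧ m ≤ i * q ∧ m ∈ S})
        ⊆ {m | 1 ≤ m ∧ m ≤ (i + 1) * q ∧ m ∈ S} := by
      have : i * q ≤ (i + 1) * q := Nat.mul_le_mul_right _ (Nat.le_succ i)
      rintro m (rfl | rfl | ⟨h1, h2, h3⟩)
      · exact ⟨by omega, hbi, hb⟩
      · exact ⟨by omega, by omega, ha⟩
      · exact ⟨h1, by omega, h3⟩
    have h := Set.ncard_le_ncard hsub (hfin _)
    rw [Set.ncard_insert_of_notMem _ ((hfin _).insert _),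
      Set.ncard_insert_of_notMem _ (hfin _), hcard' i hi.le, hcard' (i + 1) hi] at h
    · omega
    · rintro ⟨-, h, -⟩
      omega
    · rintro (h | ⟨-, h, -⟩) <;> omega
  have hqS : q ∈ S := by
    have hne : {m | 1 ≤ m ∧ m ≤ 1 * q ∧ m ∈ S}.Nonempty := by
      rw [← Set.ncard_pos (hfin _), hcard' 1 (by omega)]
      exact one_pos
    obtain ⟨x, hx1, hxq, hxS⟩ := hne
    rw [one_mul] at hxq
    have hblock : ∀ j, j ≤ r → j * q < (j + 1) * x := by
      intro j
      induction j with
      | zero => intro _; omega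
      | succ j ih =>
        intro hj
        by_contra! hcon
        refine huniq j (by omega) _ (hmul x hxS (j + 1) (by omega)) _
          (hmul x hxS (j + 1 + 1) (by omega)) (ih (by omega)) ?_ hcon
        exact Nat.mul_lt_mul_of_pos_right (Nat.lt_succ_self _) hx1
    have h := hblock (q - 1) hr
    rw [Nat.sub_add_cancel hq.le, mul_comm] at h
    have := Nat.lt_of_mul_lt_mul_left h
    obtain rfl : x = q := by omega
    exact hxS
  constructor
  · intro hmS
    by_contra hndvd
    have hlt : m < (m / q + 1) * q := by
      rw [mul_comm]; exact Nat.lt_mul_div_succ m (by omega)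
    have hle : m / q * q ≤ m := Nat.div_mul_le_self m q
    have hne : m / q * q ≠ m := fun h => hndvd ⟨m / q, by rw [mul_comm]; exact h.symm⟩
    refine huniq (m / q) ?_ m hmS _ (hmul q hqS (m / q + 1) (Nat.succ_pos _)) (by omega) hlt le_rfl
    by_contra! hcon
    have := Nat.mul_le_mul_right q hcon
    omega
  · rintro ⟨k, rfl⟩
    rw [mul_comm]
    exact hmul q hqS k (Nat.one_le_iff_ne_zero.2 (by rintro rfl; simp at hm))

theorem adeg_eq_zero_iff_isUnit (F : Type*) {A : Type*} [Field F] [CommRing A] [Algebra F A]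
    (a : A) [Module.Finite F (A ⧸ Ideal.span {a})] : adeg F a = 0 ↔ IsUnit a := by
  rw [adeg, Module.finrank_zero_iff, Ideal.Quotient.subsingleton_iff,
    Ideal.span_singleton_eq_top]

theorem adeg_pow (F : Type*) {A : Type*} [Field F] [CommRing A] [IsDomain A] [Algebra F A]
    (hdegfin : ∀ a : A, a ≠ 0 → Module.Finite F (A ⧸ Ideal.span {a}))
    {a : A} (ha : a ≠ 0) (k : ℕ) : adeg F (a ^ k) = k * adeg F a := by
  induction k with
  | zero =>
    have := hdegfin 1 one_ne_zero
    simp [adeg_eq_zero_iff_isUnit]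
  | succ k ih => rw [pow_succ, adeg_mul F hdegfin (pow_ne_zero k ha) ha, ih]; ring

theorem sum_X_pow_eq_of_partial_sums {R : Type*} [CommRing R] (q k : ℕ) (c S : ℕ → R)
    (h0 : S 0 = c 0) (hS : ∀ i, S (i + 1) = S i + c (i + 1)) :
    ∑ i ∈ Finset.range (k + 1), C (c i) * X ^ (i * q)
      = (1 - X ^ q) * ∑ i ∈ Finset.range k, C (S i) * X ^ (i * q) + C (S k) * X ^ (k * q) := by
  induction k with
  | zero => simp [h0]
  | succ k ih =>
    rw [Finset.sum_range_succ, ih, Finset.sum_range_succ, hS k, C_add, add_mul k 1 q, pow_add]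
    ring

theorem one_sub_X_pow_card (F A : Type*) [Field F] [Fintype F] [CommRing A] [Algebra F A] :
    (1 - X ^ Fintype.card F : A[X]) = -(X - C 1) ^ Fintype.card F := by
  have h := map_sub (FiniteField.frobeniusAlgHom F A[X]) X 1
  simp only [FiniteField.coe_frobeniusAlgHom, one_pow] at h
  rw [C_1, h, neg_sub]

theorem rootMultiplicity_one_sub_X_pow_card_mul (F : Type*) {A : Type*} [Field F] [Fintype F]
    [CommRing A] [Algebra F A] {P : A[X]} (hP : P.eval 1 ≠ 0) :
    rootMultiplicity 1 ((1 - X ^ Fintype.card F) * P) = Fintype.card F := by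
  have hP' : (-P).eval 1 ≠ 0 := by simpa using hP
  rw [one_sub_X_pow_card F A, neg_mul, ← mul_neg, mul_comm,
    rootMultiplicity_mul_X_sub_C_pow (by rintro h; simp [h] at hP'),
    rootMultiplicity_eq_zero hP', zero_add]

/-- Let `q = pⁿ` be a prime power and `A` an integral domain containing
`F_q` with unit group exactly `F_q^×`, finite degrees `deg a = dim_{F_q}(A/aA)` for `a ≠ 0`,
subspaces `V_n = {a : a = 0 ∨ deg a ≤ n}` with `dim V_n = 1 + #{m ≤ n nongap}`, and finitely
many gaps, `g` in number.  Assume `A` has an `r`-gap structure at `∞` with `r ≥ q − 1`, i.e.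
`dim V_{iq} = i + 1` for `1 ≤ i ≤ r`, `dim V_{g+r} = r + 1`, and `rq ≤ g + r`.  Then for
every positive multiple `s` of `q − 1` with `l_q(s) ≤ r(q − 1)`, the zeta polynomial
`Z_s(X)` (which has finitely many nonzero coefficients) vanishes at `X = 1` to order
exactly `q`. -/
theorem statement11 (F : Type*) [Field F] [Fintype F] (q : ℕ) (hq : q = Fintype.card F)
    (A : Type*) [CommRing A] [IsDomain A] [Algebra F A]
    (hunit : ∀ u : Aˣ, ∃ t : F, t ≠ 0 ∧ (u : A) = algebraMap F A t)
    (hunit' : ∀ t : F, t ≠ 0 → IsUnit (algebraMap F A t))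
    (hdegfin : ∀ a : A, a ≠ 0 → Module.Finite F (A ⧸ Ideal.span {a}))
    (V : ℕ → Submodule F A)
    (hV : ∀ n : ℕ, (V n : Set A) = {a : A | a = 0 ∨ adeg F a ≤ n})
    (hVdim : ∀ n : ℕ, Module.finrank F (V n) =
      1 + Set.ncard {m : ℕ | 1 ≤ m ∧ m ≤ n ∧ ¬ IsGapA F A m})
    (g : ℕ) (hgfin : {m : ℕ | 1 ≤ m ∧ IsGapA F A m}.Finite)
    (hg : {m : ℕ | 1 ≤ m ∧ IsGapA F A m}.ncard = g)
    (r : ℕ) (hr : q - 1 ≤ r)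
    (hgap1 : ∀ i : ℕ, 1 ≤ i → i ≤ r → Module.finrank F (V (i * q)) = i + 1)
    (hgap2 : Module.finrank F (V (g + r)) = r + 1)
    (hgap3 : r * q ≤ g + r)
    (s : ℕ) (hs : 1 ≤ s) (hdvd : (q - 1) ∣ s) (hls : lq q s ≤ r * (q - 1)) :
    {d : ℕ | zetaCoeff F (A := A) s d ≠ 0}.Finite ∧
      rootMultiplicity 1 (zetaPoly F A s) = q := by
  classical
  have hq1 : 1 < q := hq ▸ Fintype.one_lt_card
  have hmem : ∀ n a, a ∈ V n ↔ a = 0 ∨ adeg F a ≤ n := fun n a => by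
    rw [← SetLike.mem_coe, hV]; rfl
  have hfinite : ∀ n, Module.Finite F (V n) := fun n =>
    Module.finite_of_finrank_pos (by rw [hVdim]; omega)
  have hfin : ∀ n, Finite (V n) := fun n => Module.finite_of_finite F
  have hfint : ∀ n, Fintype (V n) := fun n => Fintype.ofFinite _
  have hmono : Monotone V := fun m n hmn a ha => by
    rw [hmem] at ha ⊢
    exact ha.imp_right fun h => h.trans hmn
  -- the degrees that occur up to `r * q` are the multiples of `q`
  have hdeg : ∀ m, 1 ≤ m → m ≤ r * q → ((∃ a : A, a ≠ 0 ∧ adeg F a = m) ↔ q ∣ m) := by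
    intro m hm hmr
    refine mem_iff_dvd_of_ncard_eq (S := {m | ∃ a : A, a ≠ 0 ∧ adeg F a = m}) hq1 hr ?_ ?_ hm hmr
    · rintro _ ⟨a, ha, rfl⟩ k -
      exact ⟨a ^ k, pow_ne_zero k ha, adeg_pow F hdegfin ha k⟩
    · intro i hi hir
      have h := hVdim (i * q)
      rw [hgap1 i hi hir] at h
      simp only [IsGapA, not_not] at h
      simp only [Set.mem_ofPred_eq]
      omega
  let T : ℕ → A := fun n => ∑ w : V n, (w : A) ^ s
  have hT : ∀ n, T n = ∑ᶠ a ∈ (V n : Set A), a ^ s := fun n => by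
    rw [← finsum_set_coe_eq_finsum_mem, finsum_eq_sum_of_fintype]
    rfl
  have hVfin : ∀ n, (V n : Set A).Finite := fun n => Set.toFinite _
  have hDfin : ∀ n, {a : A | a ≠ 0 ∧ adeg F a = n}.Finite := fun n =>
    (hVfin n).subset fun a ha => (hmem n a).2 (Or.inr ha.2.le)
  have hT0 : T 0 = zetaCoeff F s 0 := by
    have hset : (V 0 : Set A) = {0} ∪ {a : A | a ≠ 0 ∧ adeg F a = 0} := by
      ext a
      rw [SetLike.mem_coe, hmem]
      by_cases ha : a = 0 <;> simp [ha]
    rw [hT, hset, finsum_mem_union (by simp) (Set.finite_singleton 0) (hDfin 0),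
      finsum_mem_singleton, zero_pow (by omega), zero_add, zetaCoeff]
  have hTsucc : ∀ n, T (n + 1) = T n + zetaCoeff F s (n + 1) := by
    intro n
    have hset : (V (n + 1) : Set A)
        = (V n : Set A) ∪ {a : A | a ≠ 0 ∧ adeg F a = n + 1} := by
      ext a
      rw [SetLike.mem_coe, hmem, Set.mem_union, SetLike.mem_coe, hmem, Nat.le_succ_iff]
      by_cases ha : a = 0 <;> simp [ha]
    have hdisj : Disjoint (V n : Set A) {a : A | a ≠ 0 ∧ adeg F a = n + 1} := by
      rw [Set.disjoint_left]
      rintro a ha ⟨ha0, hda⟩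
      rcases (hmem n a).1 ha with h | h
      · exact ha0 h
      · omega
    rw [hT, hset, finsum_mem_union hdisj (hVfin n) (hDfin _), ← hT, zetaCoeff]
  have hTlarge : ∀ n, r * q ≤ n → T n = 0 := by
    intro n hn
    refine sum_submodule_pow_eq_zero (V n) ?_
    rw [← hq]
    have h1 : r + 1 ≤ Module.finrank F (V n) := by
      rw [← hgap1 r (by omega) le_rfl]
      exact Submodule.finrank_mono (hmono hn)
    calc lq q s ≤ (q - 1) * r := by rw [mul_comm]; exact hls
      _ < (q - 1) * (r + 1) := Nat.mul_lt_mul_of_pos_left (Nat.lt_succ_self r) (by omega)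
      _ ≤ _ := Nat.mul_le_mul_left _ h1
  have hc : ∀ d, d ∉ (Finset.range (r + 1)).image (· * q) → zetaCoeff F (A := A) s d = 0 := by
    intro d hd
    have hd0 : d ≠ 0 := by
      rintro rfl
      exact hd (Finset.mem_image.2 ⟨0, by simp, by simp⟩)
    rcases le_or_gt d (r * q) with hdr | hdr
    · have hnd : ¬ q ∣ d := by
        rintro ⟨k, rfl⟩
        refine hd (Finset.mem_image.2 ⟨k, ?_, mul_comm _ _⟩)
        rw [Finset.mem_range, Nat.lt_succ_iff]
        rw [mul_comm] at hdr
        exact Nat.le_of_mul_le_mul_right hdr (by omega)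
      rw [← hdeg d (by omega) hdr] at hnd
      have : {a : A | a ≠ 0 ∧ adeg F a = d} = ∅ :=
        Set.eq_empty_iff_forall_notMem.2 fun a ha => hnd ⟨a, ha⟩
      rw [zetaCoeff, this, finsum_mem_empty]
    · obtain ⟨n, rfl⟩ := Nat.exists_eq_succ_of_ne_zero hd0
      have h := hTsucc n
      rw [hTlarge n (by omega), hTlarge (n + 1) (by omega), zero_add] at h
      exact h.symm
  have hTblock : ∀ i, T ((i + 1) * q) = T (i * q) + zetaCoeff F s ((i + 1) * q) := by
    intro i
    have hconst : ∀ k, k < q → T (i * q + k) = T (i * q) := by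
      intro k
      induction k with
      | zero => intro _; rfl
      | succ k ih =>
        intro hk
        rw [← add_assoc, hTsucc, ih (by omega), hc, add_zero]
        intro h
        obtain ⟨j, -, hj⟩ := Finset.mem_image.1 h
        have h1 : q ∣ i * q + (k + 1) := ⟨j, by rw [mul_comm q j, hj, add_assoc]⟩
        rw [Nat.dvd_add_right (dvd_mul_left q i)] at h1
        exact absurd (Nat.le_of_dvd (by omega) h1) (by omega)
    have h := hTsucc (i * q + (q - 1))
    rwa [hconst (q - 1) (by omega),
      show i * q + (q - 1) + 1 = (i + 1) * q by rw [add_mul]; omega] at h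
  refine ⟨((Finset.range (r + 1)).image (· * q)).finite_toSet.subset fun d hd => ?_, ?_⟩
  · by_contra h
    exact hd (hc d h)
  have hZ : zetaPoly F A s
      = (1 - X ^ q) * ∑ i ∈ Finset.range r, C (T (i * q)) * X ^ (i * q) := by
    rw [zetaPoly, finsum_eq_sum_of_support_subset (s := (Finset.range (r + 1)).image (· * q)),
      Finset.sum_image fun i _ j _ h => Nat.eq_of_mul_eq_mul_right (by omega) h,
      sum_X_pow_eq_of_partial_sums q r (fun i => zetaCoeff F s (i * q)) (fun i => T (i * q))
        (by simpa using hT0) hTblock,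
      hTlarge _ le_rfl, C_0, zero_mul, add_zero]
    intro d hd
    by_contra h
    exact hd (by simp only [hc d h, C_0, zero_mul])
  rw [hZ, hq]
  apply rootMultiplicity_one_sub_X_pow_card_mul
  rw [← hq]
  simp only [eval_finsetSum, eval_mul, eval_C, eval_pow, eval_X, one_pow, mul_one]
  have hT0' : T 0 = -1 := by
    have hconst : ∀ t : F, algebraMap F A t ∈ V 0 := by
      intro t
      rw [hmem]
      rcases eq_or_ne t 0 with rfl | ht
      · simp
      · have hne : algebraMap F A t ≠ 0 := by simpa using ht
        have := hdegfin _ hne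
        exact Or.inr ((adeg_eq_zero_iff_isUnit F _).2 ((IsUnit.mk0 t ht).map _)).le
    have hbij : Function.Bijective (fun t : F => (⟨algebraMap F A t, hconst t⟩ : V 0)) := by
      constructor
      · intro t u h
        exact (algebraMap F A).injective (congrArg Subtype.val h)
      · rintro ⟨a, ha⟩
        rcases eq_or_ne a 0 with rfl | h0
        · exact ⟨0, by simp⟩
        · have := hdegfin a h0
          obtain ⟨u, rfl⟩ := (adeg_eq_zero_iff_isUnit F a).1
            (Nat.le_zero.1 (((hmem 0 a).1 ha).resolve_left h0))
          obtain ⟨t, -, ht⟩ := hunit u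
          exact ⟨t, Subtype.ext ht.symm⟩
    have h := congrArg (algebraMap F A) (sum_pow_eq_neg_one F (by omega) (hq ▸ hdvd) (s := s))
    rw [map_sum, map_neg, map_one] at h
    rw [← h]
    exact ((Function.Bijective.sum_comp hbij fun w : V 0 => (w : A) ^ s).symm.trans
      (by simp))
  obtain ⟨x, hx0, hxq⟩ := (hdeg q (by omega) (Nat.le_mul_of_pos_left q (by omega))).2 dvd_rfl
  have hxfin := hdegfin x hx0
  have hnontriv : Nontrivial (A ⧸ Ideal.span {x}) :=
    Module.nontrivial_of_finrank_pos (R := F) (by rw [adeg] at hxq; omega)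
  intro h
  have h1 := congrArg (Ideal.Quotient.mkₐ F (Ideal.span {x})) h
  obtain ⟨r', rfl⟩ : ∃ r', r = r' + 1 := ⟨r - 1, by omega⟩
  rw [Finset.sum_range_succ', map_add, map_sum, Finset.sum_eq_zero, zero_mul, hT0', map_neg,
    map_one, map_zero, zero_add, neg_eq_zero] at h1
  · exact one_ne_zero h1
  · intro i _
    simp only [T, map_sum, map_pow]
    refine sum_submodule_map_pow_eq_zero _ _ ((hmem _ x).2 (Or.inr ?_)) hx0 ?_ s
    · rw [hxq]; exact Nat.le_mul_of_pos_left q (by omega)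
    · exact Ideal.Quotient.eq_zero_iff_mem.2 (Ideal.mem_span_singleton_self x)
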